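/- Let F₃ be the Frucht graph, i.e., the graph on vertex set {0, 1, …, 11} with edge set {01, 06, 07, 12, 17, 23, 28, 34, 39, 45, 49, 56, 5-10, 6-10, 7-11, 89, 8-11, 10-11}. Then F₃ is a 3-regular nut graph on 12 vertices, and the characteristic polynomial of its adjacency matrix equals x(x − 3)(x − 2)(x + 1)(x + 2)(x³ + x² − 2x − 1)(x⁴ + x³ − 6x² − 5x + 4). -/

import Mathlib

open SimpleGraph Matrix Module

open Classical in
/-- The real adjacency matrix of a simple graph. -/
noncomputable def adjMatR {V : Type*} [Fintype V] (G : SimpleGraph V) : Matrix V V ℝ :=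
  Matrix.of fun u v => if G.Adj u v then (1 : ℝ) else 0

/-- A nut graph: the kernel of the real adjacency matrix is one-dimensional and every
nonzero kernel vector has all entries nonzero. -/
def IsNutGraph {V : Type*} [Fintype V] (G : SimpleGraph V) : Prop :=
  Module.finrank ℝ (LinearMap.ker (adjMatR G).mulVecLin) = 1 ∧
    ∀ x : V → ℝ, (adjMatR G).mulVec x = 0 → x ≠ 0 → ∀ v, x v ≠ 0

/-- A graph is `d`-regular if every vertex has exactly `d` neighbours. -/
def IsRegularOfDeg {V : Type*} (G : SimpleGraph V) (d : ℕ) : Prop :=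
  ∀ v, (G.neighborSet v).ncard = d

/-- The circulant graph `Circ(n, S)` on vertex set `ℤ_n`. -/
def Circ (n : ℕ) (S : Finset ℕ) : SimpleGraph (ZMod n) :=
  SimpleGraph.circulantGraph ((fun k : ℕ => (k : ZMod n)) '' (S : Set ℕ))

/-- The Cayley graph `Cay(Γ, C)` (for `C` inversion-closed with `1 ∉ C`). -/
def cayleyGraph {Γ : Type*} [Group Γ] (C : Set Γ) : SimpleGraph Γ :=
  SimpleGraph.fromRel (fun u v => v * u⁻¹ ∈ C)

/-- Additive version of the Cayley graph. -/
def addCayleyGraph {Γ : Type*} [AddGroup Γ] (C : Set Γ) : SimpleGraph Γ :=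
  SimpleGraph.fromRel (fun u v => v - u ∈ C)

/-- A graph is a Cayley graph if it is isomorphic to `Cay(Γ, C)` for some finite group `Γ`
and some inversion-closed connection set `C ⊆ Γ \ {1}`. -/
def IsCayleyGraph {V : Type u} (G : SimpleGraph V) : Prop :=
  ∃ (Γ : Type u) (_ : Group Γ) (_ : Fintype Γ) (C : Set Γ),
    (1 : Γ) ∉ C ∧ (∀ c ∈ C, c⁻¹ ∈ C) ∧ Nonempty (G ≃g cayleyGraph C)

/-- The edge list of the Frucht graph. -/
def fruchtEdges : List (ℕ × ℕ) :=
  [(0,1),(0,6),(0,7),(1,2),(1,7),(2,3),(2,8),(3,4),(3,9),(4,5),(4,9),(5,6),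
   (5,10),(6,10),(7,11),(8,9),(8,11),(10,11)]

/-- The Frucht graph `F₃` on `12` vertices. -/
def fruchtGraph : SimpleGraph (Fin 12) :=
  SimpleGraph.fromRel (fun u v => ((u : ℕ), (v : ℕ)) ∈ fruchtEdges)

section Krylov

variable {R : Type*} [CommRing R] {n : ℕ}

/-- If `w` is the Krylov sequence of `w 0` under `A`, then `q(A)` sends `w 0` to the combination
of the `w j` with the coefficients of `q`. -/
theorem aeval_mulVec_krylov (A : Matrix (Fin n) (Fin n) R) (w : Fin (n + 1) → Fin n → R)
    (hw : ∀ j : Fin n, A *ᵥ w j.castSucc = w j.succ) (q : Polynomial R) (hq : q.natDegree ≤ n) :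
    Polynomial.aeval A q *ᵥ w 0 = ∑ j : Fin (n + 1), q.coeff j • w j := by
  have hpow : ∀ j : Fin (n + 1), (A ^ (j : ℕ)) *ᵥ w 0 = w j := by
    intro j
    induction j using Fin.induction with
    | zero => simp
    | succ j ih =>
      rw [Fin.val_succ, pow_succ', ← mulVec_mulVec, ← hw j, ← ih, Fin.val_castSucc]
  rw [Polynomial.aeval_eq_sum_range' (Nat.lt_succ_of_le hq), Finset.sum_range, sum_mulVec]
  exact Finset.sum_congr rfl fun j _ => by rw [smul_mulVec, hpow]

/-- A monic polynomial of degree `n` is the characteristic polynomial of `A` as soon as it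
annihilates a cyclic vector of `A`. -/
theorem charpoly_eq_of_krylov (A : Matrix (Fin n) (Fin n) R) (w : Fin (n + 1) → Fin n → R)
    (hw : ∀ j : Fin n, A *ᵥ w j.castSucc = w j.succ)
    (hli : LinearIndependent R fun j : Fin n => w j.castSucc)
    (p : Polynomial R) (hp : p.Monic) (hdeg : p.natDegree = n)
    (h : ∑ j : Fin (n + 1), p.coeff j • w j = 0) : A.charpoly = p := by
  nontriviality R
  have hcdeg : A.charpoly.natDegree = n := by simp [charpoly_natDegree_eq_dim]
  have hctop : A.charpoly.coeff n = 1 := by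
    simpa [hcdeg] using A.charpoly_monic.coeff_natDegree
  have hptop : p.coeff n = 1 := by simpa [hdeg] using hp.coeff_natDegree
  have hc : ∑ j : Fin (n + 1), A.charpoly.coeff j • w j = 0 := by
    rw [← aeval_mulVec_krylov A w hw _ hcdeg.le, aeval_self_charpoly, zero_mulVec]
  have hsub : ∑ j : Fin n, (A.charpoly.coeff j - p.coeff j) • w j.castSucc = 0 := by
    have := sub_eq_zero.2 (hc.trans h.symm)
    rw [← Finset.sum_sub_distrib, Fin.sum_univ_castSucc] at this
    simpa [hctop, hptop, sub_smul] using this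
  have hz := Fintype.linearIndependent_iff.1 hli _ hsub
  ext k
  rcases lt_trichotomy k n with hk | rfl | hk
  · exact sub_eq_zero.1 (hz ⟨k, hk⟩)
  · rw [hctop, hptop]
  · rw [Polynomial.coeff_eq_zero_of_natDegree_lt (hcdeg.trans_lt hk),
      Polynomial.coeff_eq_zero_of_natDegree_lt (hdeg.trans_lt hk)]

end Krylov

/-- The adjacency matrix of the Frucht graph over the integers. -/
def fruchtMatrix : Matrix (Fin 12) (Fin 12) ℤ :=
  !![
    0, 1, 0, 0, 0, 0, 1, 1, 0, 0, 0, 0;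
    1, 0, 1, 0, 0, 0, 0, 1, 0, 0, 0, 0;
    0, 1, 0, 1, 0, 0, 0, 0, 1, 0, 0, 0;
    0, 0, 1, 0, 1, 0, 0, 0, 0, 1, 0, 0;
    0, 0, 0, 1, 0, 1, 0, 0, 0, 1, 0, 0;
    0, 0, 0, 0, 1, 0, 1, 0, 0, 0, 1, 0;
    1, 0, 0, 0, 0, 1, 0, 0, 0, 0, 1, 0;
    1, 1, 0, 0, 0, 0, 0, 0, 0, 0, 0, 1;
    0, 0, 1, 0, 0, 0, 0, 0, 0, 1, 0, 1;
    0, 0, 0, 1, 1, 0, 0, 0, 1, 0, 0, 0;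
    0, 0, 0, 0, 0, 1, 1, 0, 0, 0, 0, 1;
    0, 0, 0, 0, 0, 0, 0, 1, 1, 0, 1, 0]

/-- The Krylov sequence of the basis vector at vertex `3` under `fruchtMatrix`, by rows. -/
def fruchtKrylov : Matrix (Fin 13) (Fin 12) ℤ :=
  !![
    0, 0, 0, 1, 0, 0, 0, 0, 0, 0, 0, 0;
    0, 0, 1, 0, 1, 0, 0, 0, 0, 1, 0, 0;
    0, 1, 0, 3, 1, 1, 0, 0, 2, 1, 0, 0;
    1, 0, 6, 2, 5, 1, 1, 1, 1, 6, 1, 2;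
    2, 8, 3, 17, 9, 7, 3, 3, 14, 8, 4, 3;
    14, 8, 39, 20, 32, 16, 13, 13, 14, 40, 13, 21;
    34, 66, 42, 111, 76, 58, 43, 43, 100, 66, 50, 40;
    152, 119, 277, 184, 235, 169, 142, 140, 148, 287, 141, 193;
    401, 569, 451, 799, 640, 518, 462, 464, 757, 567, 504, 429;
    1495, 1316, 2125, 1658, 1884, 1606, 1423, 1399, 1447, 2196, 1409, 1725;
    4138, 5019, 4421, 6205, 5460, 4716, 4510, 4536, 6046, 4989, 4754, 4255;
    14065, 13095, 17270, 14870, 15910, 14724, 13608, 13412, 13665, 17711, 13481, 15336;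
    40115, 44747, 41630, 50891, 47305, 42999, 42270, 42496, 50317, 44445, 43668, 40558]

/-- The inverse of the first twelve rows of `fruchtKrylov`, times `12470`. -/
def fruchtKrylovInv : Matrix (Fin 12) (Fin 12) ℤ :=
  !![
    -24940, -7774, 8218, -401467, -133917, 555248, 145689, -244704, -43978, 44121, 3998, -2824;
    12470, 52620, 135730, 249540, -138655, -360655, 22640, 158615, 5260, -28040, -1045, 1730;
    12470, 344832, 983791, 250171, -1159649, -660484, 418083, 301187, -56541, -50563, 2306, 2847;
    12470, 0, 0, 0, 0, 0, 0, 0, 0, 0, 0, 0;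
    12470, -73878, -593794, -671384, 605891, 933296, -163192, -391863, 8189, 65717, 956, -3838;
    12470, 86730, 55135, -78535, -39200, 11315, 2245, -560, 1155, 315, -105, -35;
    -24940, 28436, 486213, 582828, -398732, -769047, 49849, 321481, 14612, -54964, -2462, 3336;
    12470, -241548, -821749, -135094, 1008536, 357561, -389857, -148023, 60184, 22082, -3204, -1068;
    -24940, 96506, 402698, 39583, -490897, -155572, 196599, 71566, -31478, -11419, 1728, 576;
    -24940, -258484, -389997, 421213, 553758, -272812, -254891, 90676, 48352, -15154, -3262, 991;
    12470, 56232, 191931, 152231, -274879, -211359, 113843, 74937, -19336, -9808, 1191, 397;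
    12470, -83640, -458120, -409230, 467490, 572575, -140780, -233280, 13515, 37695, -95, -2110]

instance : DecidableRel fruchtGraph.Adj := fun u v =>
  decidable_of_iff _ (SimpleGraph.fromRel_adj _ u v).symm

theorem fruchtMatrix_eq_of_adj :
    fruchtMatrix = Matrix.of fun u v => if fruchtGraph.Adj u v then 1 else 0 := by
  decide +kernel

theorem adjMatR_fruchtGraph :
    adjMatR fruchtGraph = fruchtMatrix.map (Int.castRingHom ℝ) := by
  ext u v
  by_cases h : fruchtGraph.Adj u v <;> simp [adjMatR, fruchtMatrix_eq_of_adj, h]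

theorem fruchtGraph_isRegularOfDeg : IsRegularOfDeg fruchtGraph 3 := by
  intro v
  rw [← SimpleGraph.coe_neighborFinset, Set.ncard_coe_finset]
  revert v
  decide +kernel

theorem fruchtKrylov_linearIndependent :
    LinearIndependent ℤ fun j : Fin 12 => fruchtKrylov j.castSucc := by
  refine linearIndependent_rows_of_det_ne_zero
    (A := Matrix.of fun j : Fin 12 => fruchtKrylov j.castSucc) fun h => ?_
  have hmul : (Matrix.of fun j : Fin 12 => fruchtKrylov j.castSucc) * fruchtKrylovInv =
      Matrix.diagonal fun _ => 12470 := by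
    decide +kernel
  simpa [h] using congrArg Matrix.det hmul

open Polynomial in
theorem charpoly_fruchtMatrix :
    fruchtMatrix.charpoly =
      X * (X - 3) * (X - 2) * (X + 1) * (X + 2) * (X ^ 3 + X ^ 2 - 2 * X - 1) *
        (X ^ 4 + X ^ 3 - 6 * X ^ 2 - 5 * X + 4) := by
  have hexp : (X * (X - 3) * (X - 2) * (X + 1) * (X + 2) * (X ^ 3 + X ^ 2 - 2 * X - 1) *
        (X ^ 4 + X ^ 3 - 6 * X ^ 2 - 5 * X + 4) : ℤ[X]) =
      X ^ 12 + C (-18) * X ^ 10 + C (-6) * X ^ 9 + C 115 * X ^ 8 + C 66 * X ^ 7 +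
        C (-309) * X ^ 6 + C (-226) * X ^ 5 + C 309 * X ^ 4 + C 244 * X ^ 3 +
        C (-68) * X ^ 2 + C (-48) * X := by
    simp only [map_neg, map_ofNat]
    ring
  rw [hexp]
  refine charpoly_eq_of_krylov _ fruchtKrylov (by decide +kernel)
    fruchtKrylov_linearIndependent _ (by monicity!) (by compute_degree!) ?_
  simp only [Fin.sum_univ_succ, coeff_add, coeff_C_mul, coeff_X_pow, coeff_X]
  decide +kernel

/-- The kernel of the adjacency matrix of the Frucht graph is spanned by one explicit vector. -/
theorem adjMatR_fruchtGraph_mulVec_eq_zero_iff (x : Fin 12 → ℝ) :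
    adjMatR fruchtGraph *ᵥ x = 0 ↔
      x = x 11 • ![-2, 1, 1, 1, 1, 1, -2, 1, -2, -2, 1, 1] := by
  rw [adjMatR_fruchtGraph]
  simp [funext_iff, Fin.forall_fin_succ, fruchtMatrix, mulVec, dotProduct, Fin.sum_univ_succ]
  constructor
  · rintro ⟨h0, h1, h2, h3, h4, h5, h6, h7, h8, h9, h10, h11⟩
    refine ⟨?_, ?_, ?_, ?_, ?_, ?_, ?_, ?_, ?_, ?_, ?_⟩ <;> linarith
  · rintro ⟨h0, h1, h2, h3, h4, h5, h6, h7, h8, h9, h10⟩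
    refine ⟨?_, ?_, ?_, ?_, ?_, ?_, ?_, ?_, ?_, ?_, ?_, ?_⟩ <;> linarith

open Polynomial in
/-- The Frucht graph is a `3`-regular nut graph on `12` vertices, with characteristic
polynomial `x(x-3)(x-2)(x+1)(x+2)(x³+x²-2x-1)(x⁴+x³-6x²-5x+4)`. -/
theorem fruchtGraph_is_nut :
    IsRegularOfDeg fruchtGraph 3 ∧ IsNutGraph fruchtGraph ∧
    Fintype.card (Fin 12) = 12 ∧
    (adjMatR fruchtGraph).charpoly =
      X * (X - 3) * (X - 2) * (X + 1) * (X + 2) * (X ^ 3 + X ^ 2 - 2 * X - 1) *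
        (X ^ 4 + X ^ 3 - 6 * X ^ 2 - 5 * X + 4) := by
  refine ⟨fruchtGraph_isRegularOfDeg, ⟨?_, ?_⟩, by simp, ?_⟩
  · refine finrank_eq_one_iff'.2 ⟨⟨![-2, 1, 1, 1, 1, 1, -2, 1, -2, -2, 1, 1], ?_⟩, ?_, ?_⟩
    · rw [LinearMap.mem_ker, mulVecLin_apply, adjMatR_fruchtGraph_mulVec_eq_zero_iff]
      exact (one_smul ℝ _).symm
    · intro h
      simpa using congrFun (congrArg Subtype.val h) 11
    · rintro ⟨x, hx⟩
      exact ⟨x 11, Subtype.ext ((adjMatR_fruchtGraph_mulVec_eq_zero_iff x).1 hx).symm⟩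
  · intro x hx hne v
    rw [adjMatR_fruchtGraph_mulVec_eq_zero_iff] at hx
    have h11 : x 11 ≠ 0 := fun h => hne (by rw [hx, h, zero_smul])
    rw [hx, Pi.smul_apply, smul_eq_mul]
    refine mul_ne_zero h11 ?_
    fin_cases v <;> simp
  · rw [adjMatR_fruchtGraph, charpoly_map, charpoly_fruchtMatrix]
    simp
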